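/- Let n ≥ 3 and let (J_cyc, a) be a partial n×n matrix over a field 𝔽 on the cycle pattern with all prescribed entries a_{ij} nonzero, and suppose a_{12}a_{23}⋯a_{n−1,n}a_{n1} = a_{11}a_{22}⋯a_{n−1,n−1}a_{nn}. Then tmr(J_cyc,a) = 1, mr(J_cyc,a) = 1, and fmr(J_cyc,a) = 1. -/

import Mathlib

open Matrix

variable {F : Type*} [Field F] {m n : Type*} [Fintype m] [Fintype n]

/-- `B` is a completion of the partial matrix `(J, a)`: it agrees with the
prescribed entries on the pattern `J`. -/
def Completes (J : Set (m × n)) (a : m → n → F) (B : Matrix m n F) : Prop :=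
  ∀ p ∈ J, B p.1 p.2 = a p.1 p.2

/-- Minimal rank of the partial matrix `(J, a)`: the minimum of the ranks of
all completions. -/
noncomputable def pmr (J : Set (m × n)) (a : m → n → F) : ℕ :=
  sInf {r : ℕ | ∃ B : Matrix m n F, Completes J a B ∧ B.rank = r}

/-- A pattern `T` is triangular if whenever `(i,j) ∈ T` and `(k,l) ∈ T`,
then `(i,l) ∈ T` or `(k,j) ∈ T`. -/
def Triangular (T : Set (m × n)) : Prop :=
  ∀ p ∈ T, ∀ q ∈ T, (p.1, q.2) ∈ T ∨ (q.1, p.2) ∈ T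

/-- Triangular minimal rank: the maximum of `pmr` over triangular
subpatterns of `J`. -/
noncomputable def ptmr (J : Set (m × n)) (a : m → n → F) : ℕ :=
  sSup {r : ℕ | ∃ T ⊆ J, Triangular T ∧ pmr T a = r}

/-- Pattern of the tensor `(J,a) ⊗ I_b`. -/
def TensorJ (J : Set (m × n)) (b : ℕ) : Set ((m × Fin b) × (n × Fin b)) :=
  {p | (p.1.1, p.2.1) ∈ J}

/-- Entries of the tensor `(J,a) ⊗ I_b`: `a i j` on the diagonal of each
`b × b` block, `0` off the diagonal. -/
def TensorA (a : m → n → F) (b : ℕ) : m × Fin b → n × Fin b → F :=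
  fun ip jq => if ip.2 = jq.2 then a ip.1 jq.1 else 0

/-- `b`-fold minimal rank `mr_b(J,a) = mr((J,a) ⊗ I_b)`. -/
noncomputable def pmrb (J : Set (m × n)) (a : m → n → F) (b : ℕ) : ℕ :=
  pmr (TensorJ J b) (TensorA a b)

/-- Fractional minimal rank: `inf_{b ≥ 1} mr_b(J,a) / b`. -/
noncomputable def pfmr (J : Set (m × n)) (a : m → n → F) : ℝ :=
  ⨅ b : ℕ+, (pmrb J a b : ℝ) / (b : ℝ)

/-- The cycle pattern on `{1,…,n} × {1,…,n}`: positions `(i,i)` for all `i`,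
`(i, i+1)` for `i ≤ n−1`, and `(n, 1)` (encoded via addition mod `n`). -/
def CycleJ (n : ℕ) [NeZero n] : Set (Fin n × Fin n) :=
  {p | p.2 = p.1 ∨ p.2 = p.1 + 1}

omit [Fintype m] in
theorem pmr_le_rank {J : Set (m × n)} {a : m → n → F} {B : Matrix m n F}
    (hB : Completes J a B) : pmr J a ≤ B.rank :=
  Nat.sInf_le ⟨B, hB, rfl⟩

omit [Fintype m] in
theorem le_pmr {J : Set (m × n)} {a : m → n → F} {k : ℕ}
    (h : ∀ B : Matrix m n F, Completes J a B → k ≤ B.rank) : k ≤ pmr J a := by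
  refine le_csInf ⟨_, a, fun _ _ => rfl, rfl⟩ ?_
  rintro _ ⟨B, hB, rfl⟩
  exact h B hB

omit [Fintype m] in
theorem card_le_rank_of_submatrix_eq_diagonal {ι : Type*} [Fintype ι] [DecidableEq ι]
    {B : Matrix m n F} {r : ι → m} {c : ι → n} {x : F} (hx : x ≠ 0)
    (h : B.submatrix r c = diagonal fun _ => x) : Fintype.card ι ≤ B.rank := by
  rw [← rank_of_isUnit (diagonal fun _ : ι => x) (isUnit_diagonal.2 (Pi.isUnit_iff.2 fun _ =>
    hx.isUnit)), ← h]
  exact B.rank_submatrix_le r c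

omit [Fintype m] in
theorem one_le_pmr {J : Set (m × n)} {a : m → n → F} {p : m × n} (hp : p ∈ J)
    (ha : a p.1 p.2 ≠ 0) : 1 ≤ pmr J a := by
  refine le_pmr fun B hB => card_le_rank_of_submatrix_eq_diagonal (ι := Unit)
    (r := fun _ => p.1) (c := fun _ => p.2) ha ?_
  ext
  simpa using hB p hp

omit [Fintype m] in
theorem pmr_le_one {J : Set (m × n)} {a : m → n → F} {u : m → F} {v : n → F}
    (h : ∀ p ∈ J, u p.1 * v p.2 = a p.1 p.2) : pmr J a ≤ 1 :=
  (pmr_le_rank (B := vecMulVec u v) h).trans (rank_vecMulVec_le u v)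

omit [Fintype m] in
theorem pmrb_le {J : Set (m × n)} {a : m → n → F} {u : m → F} {v : n → F}
    (h : ∀ p ∈ J, u p.1 * v p.2 = a p.1 p.2) (b : ℕ) : pmrb J a b ≤ b := by
  let P : Matrix (m × Fin b) (Fin b) F := fun i q => if i.2 = q then u i.1 else 0
  let Q : Matrix (Fin b) (n × Fin b) F := fun q j => if q = j.2 then v j.1 else 0
  have hPQ : Completes (TensorJ J b) (TensorA a b) (P * Q) := by
    rintro ⟨⟨i, p⟩, ⟨j, q⟩⟩ hp
    have := h (i, j) hp
    rw [Matrix.mul_apply]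
    simp only [P, Q, TensorA, ite_mul, zero_mul, Finset.sum_ite_eq',
      Finset.mem_univ, if_true, mul_ite, mul_zero, ← this]
  calc pmrb J a b ≤ (P * Q).rank := pmr_le_rank hPQ
    _ ≤ P.rank := rank_mul_le_left P Q
    _ ≤ b := by simpa using P.rank_le_card_width

omit [Fintype m] in
theorem le_pmrb {J : Set (m × n)} {a : m → n → F} {p : m × n} (hp : p ∈ J)
    (ha : a p.1 p.2 ≠ 0) (b : ℕ) : b ≤ pmrb J a b := by
  refine le_pmr fun B hB => ?_
  have hsub : B.submatrix (fun q : Fin b => (p.1, q)) (fun q => (p.2, q)) =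
      diagonal fun _ => a p.1 p.2 := by
    ext q r
    simpa [diagonal_apply, TensorA] using hB ((p.1, q), (p.2, r)) hp
  simpa using card_le_rank_of_submatrix_eq_diagonal ha hsub

omit [Fintype m] in
theorem pfmr_eq_one {J : Set (m × n)} {a : m → n → F} {u : m → F} {v : n → F}
    (h : ∀ p ∈ J, u p.1 * v p.2 = a p.1 p.2) {p : m × n} (hp : p ∈ J)
    (ha : a p.1 p.2 ≠ 0) : pfmr J a = 1 := by
  have hb : ∀ b : ℕ+, (pmrb J a b : ℝ) / (b : ℝ) = 1 := fun b => by
    rw [(pmrb_le h b).antisymm (le_pmrb hp ha b)]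
    exact div_self (by exact_mod_cast b.ne_zero)
  simp [pfmr, hb]

omit [Fintype m] in
theorem ptmr_eq_one {J : Set (m × n)} {a : m → n → F} {u : m → F} {v : n → F}
    (h : ∀ p ∈ J, u p.1 * v p.2 = a p.1 p.2) {p : m × n} (hp : p ∈ J)
    (ha : a p.1 p.2 ≠ 0) : ptmr J a = 1 := by
  have hle : ∀ T ⊆ J, pmr T a ≤ 1 := fun T hT => pmr_le_one fun q hq => h q (hT hq)
  have hpJ : {p} ⊆ J := Set.singleton_subset_iff.2 hp
  refine IsGreatest.csSup_eq ⟨⟨{p}, hpJ, ?_, ?_⟩, ?_⟩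
  · rintro _ rfl _ rfl
    exact Or.inl rfl
  · exact (hle _ hpJ).antisymm (one_le_pmr rfl ha)
  · rintro _ ⟨T, hT, -, rfl⟩
    exact hle T hT

/-- Partial products around a cycle: if the `c i` multiply to `1`, they are the successive
ratios of a function on `Fin n`. -/
theorem exists_mul_eq_succ {M : Type*} [CommMonoid M] {n : ℕ} [NeZero n] (c : Fin n → M)
    (hc : ∏ i, c i = 1) : ∃ v : Fin n → M, ∀ i, v (i + 1) = v i * c i := by
  obtain ⟨k, rfl⟩ := Nat.exists_eq_succ_of_ne_zero (NeZero.ne n)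
  refine ⟨fun i => ∏ j ∈ Finset.Iio i, c j, fun i => ?_⟩
  have hprod : (∏ j ∈ Finset.Iio i, c j) * c i = ∏ j ∈ Finset.Iic i, c j := by
    rw [← Finset.Iio_insert, Finset.prod_insert (by simp), mul_comm]
  dsimp only
  rw [hprod]
  rcases eq_or_ne i (Fin.last k) with rfl | hi
  · have hI : Finset.Iic (Fin.last k) = Finset.univ := by
      ext j
      simp [Fin.le_last]
    rw [hI, hc, Fin.last_add_one]
    exact Finset.prod_eq_one fun j hj => absurd (Finset.mem_Iio.1 hj) (Fin.not_lt_zero j)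
  · refine Finset.prod_congr ?_ fun _ _ => rfl
    ext j
    have := Fin.val_add_one_of_lt (Fin.lt_last_iff_ne_last.2 hi)
    simp only [Finset.mem_Iio, Finset.mem_Iic, Fin.lt_def, Fin.le_def]
    omega

theorem exists_rank_one_factorization {n : ℕ} [NeZero n] (a : Fin n → Fin n → F)
    (hnz : ∀ p ∈ CycleJ n, a p.1 p.2 ≠ 0)
    (heq : ∏ i : Fin n, a i (i + 1) = ∏ i : Fin n, a i i) :
    ∃ u v : Fin n → F, ∀ p ∈ CycleJ n, u p.1 * v p.2 = a p.1 p.2 := by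
  have hd : ∀ i, a i i ≠ 0 := fun i => hnz (i, i) (Or.inl rfl)
  have hs : ∀ i, a i (i + 1) ≠ 0 := fun i => hnz (i, i + 1) (Or.inr rfl)
  obtain ⟨v, hv⟩ := exists_mul_eq_succ
    (fun i => Units.mk0 (a i (i + 1)) (hs i) / Units.mk0 (a i i) (hd i)) (by
      rw [Finset.prod_div_distrib, div_eq_one]
      ext
      simpa using heq)
  refine ⟨fun i => a i i / v i, fun i => v i, ?_⟩
  rintro ⟨i, j⟩ (hj | hj) <;> dsimp only at hj ⊢ <;> subst hj
  · simp
  · have := hd i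
    simp only [hv, Units.val_mul, Units.val_div_eq_div_val, Units.val_mk0]
    field_simp

/-- For the `n × n` cycle pattern (`n ≥ 3`) with all
prescribed entries nonzero and
`a₁₂ a₂₃ ⋯ a_{n−1,n} a_{n1} = a₁₁ a₂₂ ⋯ a_{nn}`, one has
`tmr = mr = 1` and `fmr = 1`. -/
theorem stmt18 {F : Type*} [Field F] (n : ℕ) [NeZero n] (hn : 3 ≤ n)
    (a : Fin n → Fin n → F)
    (hnz : ∀ p ∈ CycleJ n, a p.1 p.2 ≠ 0)
    (heq : ∏ i : Fin n, a i (i + 1) = ∏ i : Fin n, a i i) :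
    ptmr (CycleJ n) a = 1 ∧ pmr (CycleJ n) a = 1 ∧ pfmr (CycleJ n) a = 1 := by
  obtain ⟨u, v, huv⟩ := exists_rank_one_factorization a hnz heq
  have h0 : ((0, 0) : Fin n × Fin n) ∈ CycleJ n := Or.inl rfl
  have ha := hnz _ h0
  exact ⟨ptmr_eq_one huv h0 ha, (pmr_le_one huv).antisymm (one_le_pmr h0 ha),
    pfmr_eq_one huv h0 ha⟩
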